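/- arXiv:1211.1267 — 2 statements merged into one kernel-verified Lean document; each statement's English description precedes it below -/
import Mathlib

section
/- The set of states that are constant on each generation is invariant for the finite system on Λ: if b : ℝ → ℂ^N is a solution of the toy model and β : ℝ → (Λ → ℂ) is defined by β_n(t) = b_{g(n)}(t) for n ∈ Λ_{g(n)}, then β is a solution of the finite system on Λ. -/
noncomputable section

abbrev Z2 := ℤ × ℤ

/-- The union `Λ = Λ₁ ∪ ⋯ ∪ Λ_N` of the generations `G 1, …, G N`. -/
def ΛOf (N : ℕ) (G : ℕ → Finset Z2) : Finset Z2 := (Finset.Icc 1 N).biUnion G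

/-- The toy model: a differentiable `b : ℝ → ℕ → ℂ` (relevant components `b_j`, `1 ≤ j ≤ N`,
with the convention `b₀ = b_{N+1} = 0`) satisfying
`b_j' = -i b_j² conj(b_j) + 2i conj(b_j) (b_{j-1}² + b_{j+1}²)` for `j = 1, …, N`. -/
def ToyModel (N : ℕ) (b : ℝ → ℕ → ℂ) : Prop :=
  (∀ t : ℝ, b t 0 = 0 ∧ b t (N + 1) = 0) ∧
  ∀ j : ℕ, 1 ≤ j → j ≤ N → ∀ t : ℝ,
    HasDerivAt (fun τ : ℝ => b τ j)
      (-Complex.I * (b t j) ^ 2 * (starRingEnd ℂ) (b t j) +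
        2 * Complex.I * (starRingEnd ℂ) (b t j) * ((b t (j - 1)) ^ 2 + (b t (j + 1)) ^ 2)) t

theorem generation_eq_of_mem {N : ℕ} {G : ℕ → Finset Z2}
    (hdisj : ∀ j k : ℕ, 1 ≤ j → j ≤ N → 1 ≤ k → k ≤ N → j ≠ k → Disjoint (G j) (G k))
    {g : Z2 → ℕ} (hg : ∀ n ∈ ΛOf N G, 1 ≤ g n ∧ g n ≤ N ∧ n ∈ G (g n))
    {j : ℕ} (hj : 1 ≤ j) (hjN : j ≤ N) {m : Z2} (hm : m ∈ G j) : g m = j := by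
  obtain ⟨h1, h2, h3⟩ :=
    hg m (Finset.mem_biUnion.mpr ⟨j, Finset.mem_Icc.mpr ⟨hj, hjN⟩, hm⟩)
  by_contra hne
  exact Finset.disjoint_left.mp (hdisj _ _ h1 h2 hj hjN hne) h3 hm

/-- **Corollary 2.3 (CKSTT).** States constant on each generation are invariant for the
finite system on `Λ`: if `b` solves the toy model and `β_n(t) = b_{g(n)}(t)`, then `β` solves
the finite system on `Λ`, i.e. for every `n ∈ Λ`,
`-i β_n' = -β_n |β_n|² + 2 β_{child₁(n)} β_{child₂(n)} conj(β_{spouse(n)})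
  + 2 β_{parent₁(n)} β_{parent₂(n)} conj(β_{sibling(n)})`,
the children term being omitted in the last generation and the parents term in the first. -/
theorem generation_constant_states_invariant
    (N : ℕ) (hN : 2 ≤ N) (G : ℕ → Finset Z2)
    (hdisj : ∀ j k : ℕ, 1 ≤ j → j ≤ N → 1 ≤ k → k ≤ N → j ≠ k → Disjoint (G j) (G k))
    (g : Z2 → ℕ)
    (hg : ∀ n ∈ ΛOf N G, 1 ≤ g n ∧ g n ≤ N ∧ n ∈ G (g n))
    (spouse child₁ child₂ sibling parent₁ parent₂ : Z2 → Z2)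
    (hchildren : ∀ n ∈ ΛOf N G, g n < N →
      spouse n ∈ G (g n) ∧ child₁ n ∈ G (g n + 1) ∧ child₂ n ∈ G (g n + 1))
    (hparents : ∀ n ∈ ΛOf N G, 2 ≤ g n →
      sibling n ∈ G (g n) ∧ parent₁ n ∈ G (g n - 1) ∧ parent₂ n ∈ G (g n - 1))
    (b : ℝ → ℕ → ℂ) (hb : ToyModel N b)
    (β : ℝ → Z2 → ℂ) (hβ : ∀ (t : ℝ) (n : Z2), β t n = b t (g n)) :
    ∀ n ∈ ΛOf N G, ∀ t : ℝ, ∃ d : ℂ,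
      HasDerivAt (fun τ : ℝ => β τ n) d t ∧
      -Complex.I * d =
        -β t n * ((‖β t n‖ ^ 2 : ℝ) : ℂ) +
        (if g n < N then
          2 * β t (child₁ n) * β t (child₂ n) * (starRingEnd ℂ) (β t (spouse n))
         else 0) +
        (if 2 ≤ g n then
          2 * β t (parent₁ n) * β t (parent₂ n) * (starRingEnd ℂ) (β t (sibling n))
         else 0) := by
  intro n hn t
  obtain ⟨hb0, hb'⟩ := hb
  obtain ⟨h1, h2, -⟩ := hg n hn
  have gen {j : ℕ} (hj : 1 ≤ j) (hjN : j ≤ N) {m : Z2} (hm : m ∈ G j) : g m = j :=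
    generation_eq_of_mem hdisj hg hj hjN hm
  have hchild : (if g n < N then
      2 * β t (child₁ n) * β t (child₂ n) * (starRingEnd ℂ) (β t (spouse n)) else 0) =
      2 * (starRingEnd ℂ) (b t (g n)) * b t (g n + 1) ^ 2 := by
    split_ifs with h
    · obtain ⟨hs, hc₁, hc₂⟩ := hchildren n hn h
      rw [hβ, hβ, hβ, gen h1 h2 hs, gen (by omega) h hc₁, gen (by omega) h hc₂]
      ring
    · rw [show g n + 1 = N + 1 by omega, (hb0 t).2]
      ring
  have hparent : (if 2 ≤ g n then
      2 * β t (parent₁ n) * β t (parent₂ n) * (starRingEnd ℂ) (β t (sibling n)) else 0) =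
      2 * (starRingEnd ℂ) (b t (g n)) * b t (g n - 1) ^ 2 := by
    split_ifs with h
    · obtain ⟨hs, hp₁, hp₂⟩ := hparents n hn h
      rw [hβ, hβ, hβ, gen h1 h2 hs, gen (by omega) (by omega) hp₁,
        gen (by omega) (by omega) hp₂]
      ring
    · rw [show g n - 1 = 0 by omega, (hb0 t).1]
      ring
  have hnorm : ((‖b t (g n)‖ ^ 2 : ℝ) : ℂ) = b t (g n) * (starRingEnd ℂ) (b t (g n)) := by
    rw [Complex.mul_conj']
    push_cast
    rfl
  refine ⟨_, by simpa only [hβ] using hb' (g n) h1 h2 t, ?_⟩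
  rw [hchild, hparent, hβ, hnorm]
  linear_combination (b t (g n) ^ 2 * (starRingEnd ℂ) (b t (g n)) -
    2 * (starRingEnd ℂ) (b t (g n)) * (b t (g n - 1) ^ 2 + b t (g n + 1) ^ 2)) * Complex.I_sq
end
end

section
/- Let v : ℤ² → ℝ be bounded and let a : ℝ → (ℤ² → ℂ) be a Fourier-side solution of the cubic defocusing NLS with convolution potential such that, in addition, the map t ↦ ((1+|n|²)·a_n(t))_{n∈ℤ²} is a continuous curve in ℓ¹(ℤ²;ℂ). Then the energy ℋ(a(t)) = (1/2)·Σ_{n∈ℤ²} (|n|² + v_n)·|a_n(t)|² + (1/4)·Σ_{(n₁,n₂,n₃,n₄)∈(ℤ²)⁴ : n₁−n₂+n₃=n₄} a_{n₁}(t)·conj(a_{n₂}(t))·a_{n₃}(t)·conj(a_{n₄}(t)) is independent of t (both sums converge absolutely under the hypotheses). -/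
noncomputable section

open scoped BigOperators

/-- The squared Euclidean norm `|n|²` of a mode `n ∈ ℤ²`, as a real number. -/
def nsq (n : Z2) : ℝ := (n.1 : ℝ) ^ 2 + (n.2 : ℝ) ^ 2

/-- Triples of modes. -/
abbrev Triple := Z2 × Z2 × Z2

/-- The cubic nonlinearity term `a_{n₁} ⋅ conj(a_{n₂}) ⋅ a_{n₃}` attached to a triple. -/
def cubicTerm (a : Z2 → ℂ) (p : Triple) : ℂ :=
  a p.1 * (starRingEnd ℂ) (a p.2.1) * a p.2.2

/-- A Fourier-side solution of the cubic defocusing NLS with convolution potential `V`,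
whose (real) Fourier coefficients are `v`: for every `n` and `t`, the sum over triples
`n₁ - n₂ + n₃ = n` converges absolutely, `a_n` is differentiable in `t`, and
`-i a_n'(t) = (|n|² + v_n) a_n(t) + ∑_{n₁-n₂+n₃=n} a_{n₁} conj(a_{n₂}) a_{n₃}`. -/
def IsSolutionV (v : Z2 → ℝ) (a : ℝ → Z2 → ℂ) : Prop :=
  ∀ (n : Z2) (t : ℝ),
    Summable (fun p : {p : Triple // p.1 - p.2.1 + p.2.2 = n} => ‖cubicTerm (a t) p.1‖) ∧
    ∃ d : ℂ, HasDerivAt (fun τ : ℝ => a τ n) d t ∧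
      -Complex.I * d =
        ((nsq n + v n : ℝ) : ℂ) * a t n +
          ∑' p : {p : Triple // p.1 - p.2.1 + p.2.2 = n}, cubicTerm (a t) p.1

/-- The square of the `H^s` Sobolev norm `∑ (1+|n|²)^s |a_n|²`. -/
def HsNormSq (s : ℝ) (a : Z2 → ℂ) : ℝ := ∑' n : Z2, (1 + nsq n) ^ s * ‖a n‖ ^ 2

/-- Finiteness of the `H^s` norm. -/
def HsFinite (s : ℝ) (a : Z2 → ℂ) : Prop :=
  Summable fun n : Z2 => (1 + nsq n) ^ s * ‖a n‖ ^ 2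

/-- The `H^s` Sobolev norm. -/
def HsNorm (s : ℝ) (a : Z2 → ℂ) : ℝ := HsNormSq s a ^ (1 / 2 : ℝ)

/-- The `L²` (mass) norm. -/
def L2Norm (a : Z2 → ℂ) : ℝ := (∑' n : Z2, ‖a n‖ ^ 2) ^ (1 / 2 : ℝ)

/-- `t ↦ ((1+|n|²) aₙ(t))ₙ` is a continuous curve in `ℓ¹(ℤ²; ℂ)`: each weighted sequence is
absolutely summable and the curve is continuous for the `ℓ¹` distance. -/
def WeightedL1Curve (a : ℝ → Z2 → ℂ) : Prop :=
  (∀ t : ℝ, Summable fun n : Z2 => (1 + nsq n) * ‖a t n‖) ∧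
  ∀ t₀ : ℝ, Filter.Tendsto (fun t : ℝ => ∑' n : Z2, (1 + nsq n) * ‖a t n - a t₀ n‖)
    (nhds t₀) (nhds 0)

/-- Quadruples of modes. -/
abbrev Quad4 := Z2 × Z2 × Z2 × Z2

/-- The quartic monomial `a_{n₁} conj(a_{n₂}) a_{n₃} conj(a_{n₄})` attached to a quadruple. -/
def quarticTerm (a : Z2 → ℂ) (q : Quad4) : ℂ :=
  a q.1 * (starRingEnd ℂ) (a q.2.1) * a q.2.2.1 * (starRingEnd ℂ) (a q.2.2.2)

/-- The energy
`ℋ(a) = (1/2) ∑ₙ (|n|² + vₙ)|aₙ|² + (1/4) ∑_{n₁-n₂+n₃=n₄} a_{n₁} conj(a_{n₂}) a_{n₃} conj(a_{n₄})`. -/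
def energy (v : Z2 → ℝ) (a : Z2 → ℂ) : ℂ :=
  (((1 / 2 : ℝ) * ∑' n : Z2, (nsq n + v n) * ‖a n‖ ^ 2 : ℝ) : ℂ) +
    (1 / 4 : ℂ) * ∑' q : {q : Quad4 // q.1 - q.2.1 + q.2.2.1 = q.2.2.2}, quarticTerm a q.1

/-- The mode `n₁ - n₂ + n₃` determined by a triple. -/
def outMode (p : Triple) : Z2 := p.1 - p.2.1 + p.2.2

/-- The cubic nonlinearity at mode `n`. -/
def cubicSum (a : Z2 → ℂ) (n : Z2) : ℂ :=
  ∑' p : {p : Triple // p.1 - p.2.1 + p.2.2 = n}, cubicTerm a p.1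

/-- The product of three values of a family, attached to a triple. -/
def tripleProd (A : Z2 → ℝ) (p : Triple) : ℝ := A p.1 * A p.2.1 * A p.2.2

/-- Exchanges the first and the third mode. -/
def swapFirstThird : Triple ≃ Triple where
  toFun p := (p.2.2, p.2.1, p.1)
  invFun p := (p.2.2, p.2.1, p.1)
  left_inv _ := rfl
  right_inv _ := rfl

/-- Exchanges the second mode and the output mode. -/
def swapSecondOut : Triple ≃ Triple where
  toFun p := (p.1, outMode p, p.2.2)
  invFun p := (p.1, outMode p, p.2.2)
  left_inv p := by ext <;> simp [outMode] <;> ring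
  right_inv p := by ext <;> simp [outMode] <;> ring

/-- Exchanges the first mode with the output mode and the second mode with the third. -/
def swapFirstOut : Triple ≃ Triple where
  toFun p := (outMode p, p.2.2, p.2.1)
  invFun p := (outMode p, p.2.2, p.2.1)
  left_inv p := by ext <;> simp [outMode]
  right_inv p := by ext <;> simp [outMode]

/-- Quadruples on the resonant hyperplane are parametrized by their first three modes. -/
def quadEquiv : {q : Quad4 // q.1 - q.2.1 + q.2.2.1 = q.2.2.2} ≃ Triple where
  toFun q := (q.1.1, q.1.2.1, q.1.2.2.1)
  invFun p := ⟨(p.1, p.2.1, p.2.2, outMode p), rfl⟩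
  left_inv q := by
    obtain ⟨⟨a, b, c, d⟩, h⟩ := q
    simp only [outMode, Subtype.mk.injEq, Prod.mk.injEq, true_and]
    exact h
  right_inv _ := rfl

lemma outMode_swapFirstThird (p : Triple) : outMode (swapFirstThird p) = outMode p := by
  simp only [outMode, swapFirstThird, Equiv.coe_fn_mk]; abel

lemma outMode_swapSecondOut (p : Triple) : outMode (swapSecondOut p) = p.2.1 := by
  simp only [outMode, swapSecondOut, Equiv.coe_fn_mk]; abel

lemma outMode_swapFirstOut (p : Triple) : outMode (swapFirstOut p) = p.1 := by
  simp only [outMode, swapFirstOut, Equiv.coe_fn_mk]; abel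

lemma nsq_nonneg (n : Z2) : 0 ≤ nsq n := by unfold nsq; positivity

lemma tripleProd_nonneg {A : Z2 → ℝ} (hA0 : ∀ n, 0 ≤ A n) (p : Triple) :
    0 ≤ tripleProd A p :=
  mul_nonneg (mul_nonneg (hA0 _) (hA0 _)) (hA0 _)

lemma hasSum_tripleProd {A : Z2 → ℝ} (hA : Summable A) (hA0 : ∀ n, 0 ≤ A n) :
    HasSum (tripleProd A) ((∑' n, A n) ^ 3) := by
  have h2 : Summable fun q : Z2 × Z2 => A q.1 * A q.2 := hA.mul_of_nonneg hA hA0 hA0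
  have h3 : Summable fun p : Z2 × Z2 × Z2 => A p.1 * (A p.2.1 * A p.2.2) :=
    hA.mul_of_nonneg h2 hA0 fun q => mul_nonneg (hA0 _) (hA0 _)
  have h := hA.hasSum.mul (hA.hasSum.mul hA.hasSum h2) h3
  have hfun : tripleProd A = fun p => A p.1 * (A p.2.1 * A p.2.2) :=
    funext fun p => mul_assoc _ _ _
  rw [hfun, show (∑' n, A n) ^ 3 = (∑' n, A n) * ((∑' n, A n) * ∑' n, A n) by ring]
  exact h

lemma norm_cubicTerm (a : Z2 → ℂ) (p : Triple) :
    ‖cubicTerm a p‖ = tripleProd (fun n => ‖a n‖) p := by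
  simp [cubicTerm, tripleProd]

/-- Any family which is dominated by `A` has its cubic nonlinearity dominated by a triple
convolution of `A`. -/
lemma norm_cubicSum_le {a : Z2 → ℂ} {A : Z2 → ℝ} (hA : Summable A) (haA : ∀ n, ‖a n‖ ≤ A n)
    (n : Z2) :
    ‖cubicSum a n‖ ≤ ∑' p : outMode ⁻¹' {n}, tripleProd A p := by
  have hA0 : ∀ n, 0 ≤ A n := fun n => (norm_nonneg _).trans (haA n)
  refine tsum_of_norm_bounded
    (((hasSum_tripleProd hA hA0).summable.subtype (outMode ⁻¹' {n})).hasSum) fun p => ?_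
  rw [norm_cubicTerm]
  simp only [tripleProd, Function.comp]
  have := haA p.1.1
  have := haA p.1.2.1
  have := haA p.1.2.2
  have := hA0 p.1.1
  have := hA0 p.1.2.1
  gcongr

lemma hasSum_tripleConv {A : Z2 → ℝ} (hA : Summable A) (hA0 : ∀ n, 0 ≤ A n) :
    HasSum (fun n => ∑' p : outMode ⁻¹' {n}, tripleProd A p) ((∑' n, A n) ^ 3) :=
  (hasSum_tripleProd hA hA0).tsum_fiberwise outMode

/-- The right-hand side of the equation. -/
def rhs (v : Z2 → ℝ) (a : Z2 → ℂ) (n : Z2) : ℂ :=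
  ((nsq n + v n : ℝ) : ℂ) * a n + cubicSum a n

lemma IsSolutionV.hasDerivAt {v : Z2 → ℝ} {a : ℝ → Z2 → ℂ} (ha : IsSolutionV v a)
    (n : Z2) (t : ℝ) :
    HasDerivAt (fun τ => a τ n) (Complex.I * rhs v (a t) n) t := by
  obtain ⟨-, d, hd, h⟩ := ha n t
  have : Complex.I * rhs v (a t) n = d := by
    unfold rhs cubicSum
    rw [← h, ← mul_assoc, mul_neg, Complex.I_mul_I]; ring
  rwa [this]

lemma abs_symbol_le {v : Z2 → ℝ} {M : ℝ} (hv : ∀ n, |v n| ≤ M) (n : Z2) :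
    |nsq n + v n| ≤ (1 + M) * (1 + nsq n) := by
  have hM : 0 ≤ M := (abs_nonneg _).trans (hv n)
  have h0 := nsq_nonneg n
  have h1 := abs_add_le (nsq n) (v n)
  rw [abs_of_nonneg h0] at h1
  nlinarith [hv n, mul_nonneg hM h0]

lemma norm_symbol_mul_le {v : Z2 → ℝ} {M : ℝ} (hv : ∀ n, |v n| ≤ M) (a : Z2 → ℂ) (n : Z2) :
    ‖((nsq n + v n : ℝ) : ℂ) * a n‖ ≤ (1 + M) * ((1 + nsq n) * ‖a n‖) := by
  rw [norm_mul, Complex.norm_real, Real.norm_eq_abs, ← mul_assoc]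
  exact mul_le_mul_of_nonneg_right (abs_symbol_le hv n) (norm_nonneg _)

lemma norm_le_weighted (a : Z2 → ℂ) (n : Z2) : ‖a n‖ ≤ (1 + nsq n) * ‖a n‖ :=
  le_mul_of_one_le_left (norm_nonneg _) (by linarith [nsq_nonneg n])

lemma weighted_nonneg (a : Z2 → ℂ) (n : Z2) : 0 ≤ (1 + nsq n) * ‖a n‖ :=
  (norm_nonneg _).trans (norm_le_weighted a n)

lemma summable_norm_of_weighted {a : Z2 → ℂ} (h : Summable fun n => (1 + nsq n) * ‖a n‖) :
    Summable fun n => ‖a n‖ :=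
  h.of_nonneg_of_le (fun _ => norm_nonneg _) (norm_le_weighted a)

lemma sum_norm_rhs_le {v : Z2 → ℝ} {M : ℝ} (hv : ∀ n, |v n| ≤ M) {a : Z2 → ℂ} {C : ℝ}
    (h : Summable fun n => (1 + nsq n) * ‖a n‖) (hC : ∑' n, (1 + nsq n) * ‖a n‖ ≤ C)
    (F : Finset Z2) :
    ∑ n ∈ F, ‖rhs v a n‖ ≤ (1 + M) * C + C ^ 3 := by
  have hM : 0 ≤ M := (abs_nonneg _).trans (hv 0)
  have hs := summable_norm_of_weighted h
  have hconv := hasSum_tripleConv hs fun _ => norm_nonneg _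
  have h1 : ∑ n ∈ F, (1 + nsq n) * ‖a n‖ ≤ C :=
    (h.sum_le_tsum F fun n _ => weighted_nonneg a n).trans hC
  have h2 : ∑ n ∈ F, ‖cubicSum a n‖ ≤ C ^ 3 := by
    calc ∑ n ∈ F, ‖cubicSum a n‖
        ≤ ∑ n ∈ F, ∑' p : outMode ⁻¹' {n}, tripleProd (fun n => ‖a n‖) p :=
          Finset.sum_le_sum fun n _ => norm_cubicSum_le hs (fun _ => le_rfl) n
      _ ≤ (∑' n, ‖a n‖) ^ 3 := sum_le_hasSum F
          (fun n _ => tsum_nonneg fun p => tripleProd_nonneg (fun _ => norm_nonneg _) _) hconv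
      _ ≤ C ^ 3 := by
          have := (hs.tsum_le_tsum (norm_le_weighted a) h).trans hC
          have := tsum_nonneg (L := .unconditional _) fun n => norm_nonneg (a n)
          gcongr
  calc ∑ n ∈ F, ‖rhs v a n‖
      ≤ ∑ n ∈ F, ((1 + M) * ((1 + nsq n) * ‖a n‖) + ‖cubicSum a n‖) :=
        Finset.sum_le_sum fun n _ => (norm_add_le _ _).trans
          (add_le_add (norm_symbol_mul_le hv a n) le_rfl)
    _ = (1 + M) * ∑ n ∈ F, (1 + nsq n) * ‖a n‖ + ∑ n ∈ F, ‖cubicSum a n‖ := by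
        rw [Finset.sum_add_distrib, Finset.mul_sum]
    _ ≤ (1 + M) * C + C ^ 3 := by gcongr

lemma WeightedL1Curve.exists_local_bound {a : ℝ → Z2 → ℂ} (h : WeightedL1Curve a) (t₀ : ℝ) :
    ∃ δ > 0, ∃ C : ℝ, ∀ t ∈ Set.Icc (t₀ - δ) (t₀ + δ),
      ∑' n, (1 + nsq n) * ‖a t n‖ ≤ C := by
  obtain ⟨hs, hc⟩ := h
  have hev := (hc t₀).eventually (gt_mem_nhds one_pos)
  obtain ⟨δ, hδ, hball⟩ := Metric.nhds_basis_closedBall.eventually_iff.mp hev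
  refine ⟨δ, hδ, ∑' n, (1 + nsq n) * ‖a t₀ n‖ + 1, fun t ht => ?_⟩
  rw [← Real.closedBall_eq_Icc] at ht
  have hle : ∀ n, (1 + nsq n) * ‖a t n - a t₀ n‖
      ≤ (1 + nsq n) * ‖a t n‖ + (1 + nsq n) * ‖a t₀ n‖ := fun n => by
    rw [← mul_add]
    exact mul_le_mul_of_nonneg_left (norm_sub_le _ _) (by linarith [nsq_nonneg n])
  have hd : Summable fun n => (1 + nsq n) * ‖a t n - a t₀ n‖ :=
    ((hs t).add (hs t₀)).of_nonneg_of_le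
      (fun n => weighted_nonneg (fun n => a t n - a t₀ n) n) hle
  have hle' : ∀ n, (1 + nsq n) * ‖a t n‖
      ≤ (1 + nsq n) * ‖a t₀ n‖ + (1 + nsq n) * ‖a t n - a t₀ n‖ := fun n => by
    rw [← mul_add]
    refine mul_le_mul_of_nonneg_left ?_ (by linarith [nsq_nonneg n])
    simpa using norm_add_le (a t₀ n) (a t n - a t₀ n)
  have := (hs t).tsum_le_tsum hle' ((hs t₀).add hd)
  rw [(hs t₀).tsum_add hd] at this
  linarith [hball ht]

/-- Locally in time, a solution is dominated mode by mode by a fixed summable family. -/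
lemma IsSolutionV.exists_dominating {v : Z2 → ℝ} {M : ℝ} (hv : ∀ n, |v n| ≤ M)
    {a : ℝ → Z2 → ℂ} (ha : IsSolutionV v a) (hcurve : WeightedL1Curve a) {t₀ δ C : ℝ}
    (hδ : 0 < δ)
    (hC : ∀ t ∈ Set.Icc (t₀ - δ) (t₀ + δ), ∑' n, (1 + nsq n) * ‖a t n‖ ≤ C) :
    ∃ A : Z2 → ℝ, Summable A ∧ ∀ t ∈ Set.Icc (t₀ - δ) (t₀ + δ), ∀ n, ‖a t n‖ ≤ A n := by
  set J := Set.Icc (t₀ - δ) (t₀ + δ) with hJ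
  set D := (1 + M) * C + C ^ 3
  have hsum : ∀ t ∈ J, ∀ F : Finset Z2, ∑ n ∈ F, ‖rhs v (a t) n‖ ≤ D := fun t ht F =>
    sum_norm_rhs_le hv (hcurve.1 t) (hC t ht) F
  have hderiv : ∀ n, deriv (fun τ => a τ n) = fun t => Complex.I * rhs v (a t) n := fun n =>
    funext fun t => (ha.hasDerivAt n t).deriv
  have hint : ∀ n, MeasureTheory.IntegrableOn (fun t => Complex.I * rhs v (a t) n) J := fun n => by
    refine MeasureTheory.Measure.integrableOn_of_bounded (M := D) (by simp [hJ]) ?_ ?_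
    · rw [← hderiv n]
      exact (stronglyMeasurable_deriv _).aestronglyMeasurable
    · refine (MeasureTheory.ae_restrict_iff' measurableSet_Icc).mpr (.of_forall fun t ht => ?_)
      simpa using hsum t ht {n}
  have hintn : ∀ n, MeasureTheory.IntegrableOn (fun t => ‖Complex.I * rhs v (a t) n‖) J :=
    fun n => (hint n).norm
  refine ⟨fun n => ‖a t₀ n‖ + ∫ t in J, ‖Complex.I * rhs v (a t) n‖,
    (summable_norm_of_weighted (hcurve.1 t₀)).add
      (summable_of_sum_le (c := ∫ _ in J, D) (fun n => by positivity) fun F => ?_),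
    fun t ht n => ?_⟩
  · rw [← MeasureTheory.integral_finsetSum _ fun n _ => hintn n]
    refine MeasureTheory.setIntegral_mono_on
      (MeasureTheory.integrable_finsetSum _ fun n _ => hintn n) (by simp [hJ])
      measurableSet_Icc fun t ht => ?_
    simpa using hsum t ht F
  · have ht₀ : t₀ ∈ J := ⟨by linarith, by linarith⟩
    have hsub : Set.uIoc t₀ t ⊆ J :=
      Set.uIoc_subset_uIcc.trans (Set.OrdConnected.uIcc_subset Set.ordConnected_Icc ht₀ ht)
    have hii : IntervalIntegrable (fun t => Complex.I * rhs v (a t) n) MeasureTheory.volume t₀ t :=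
      intervalIntegrable_iff.mpr ((hint n).mono_set hsub)
    have hftc := intervalIntegral.integral_eq_sub_of_hasDerivAt
      (fun s _ => ha.hasDerivAt n s) hii
    have h1 : ‖a t n - a t₀ n‖ ≤ ∫ t in J, ‖Complex.I * rhs v (a t) n‖ := by
      rw [← hftc]
      refine intervalIntegral.norm_integral_le_integral_norm_uIoc.trans ?_
      exact MeasureTheory.setIntegral_mono_set (hintn n)
        (.of_forall fun _ => norm_nonneg _) hsub.eventuallyLE
    have h2 := norm_add_le (a t₀ n) (a t n - a t₀ n)
    rw [add_sub_cancel] at h2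
    exact h2.trans (add_le_add le_rfl h1)

/-- The quartic monomial with one family in each slot, the fourth mode being `outMode p`. -/
def quarticForm (b c e f : Z2 → ℂ) (p : Triple) : ℂ :=
  b p.1 * (starRingEnd ℂ) (c p.2.1) * e p.2.2 * (starRingEnd ℂ) (f (outMode p))

lemma quarticForm_swapFirstThird (b c e f : Z2 → ℂ) (p : Triple) :
    quarticForm b c e f (swapFirstThird p) = quarticForm e c b f p := by
  unfold quarticForm
  rw [outMode_swapFirstThird]
  simp only [swapFirstThird, Equiv.coe_fn_mk]
  ring

lemma quarticForm_swapSecondOut (b c e f : Z2 → ℂ) (p : Triple) :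
    quarticForm b c e f (swapSecondOut p) = quarticForm b f e c p := by
  unfold quarticForm
  rw [outMode_swapSecondOut]
  simp only [swapSecondOut, Equiv.coe_fn_mk]
  ring

lemma quarticForm_swapFirstOut (b c e f : Z2 → ℂ) (p : Triple) :
    quarticForm b c e f (swapFirstOut p) = (starRingEnd ℂ) (quarticForm f e c b p) := by
  unfold quarticForm
  rw [outMode_swapFirstOut]
  simp only [swapFirstOut, Equiv.coe_fn_mk, map_mul, Complex.conj_conj]
  ring

lemma quarticTerm_eq_quarticForm (a : Z2 → ℂ)
    (q : {q : Quad4 // q.1 - q.2.1 + q.2.2.1 = q.2.2.2}) :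
    quarticTerm a q.1 = quarticForm a a a a (quadEquiv q) := by
  obtain ⟨q, hq⟩ := q
  simp only [quarticTerm, quarticForm, quadEquiv, Equiv.coe_fn_mk, outMode, hq]

lemma norm_quarticForm_le {a d : Z2 → ℂ} {A : Z2 → ℝ} {D : ℝ}
    (haA : ∀ n, ‖a n‖ ≤ A n) (hd : ∀ n, ‖d n‖ ≤ D) (p : Triple) :
    ‖quarticForm a a a d p‖ ≤ D * tripleProd A p := by
  have hA0 : ∀ n, 0 ≤ A n := fun n => (norm_nonneg _).trans (haA n)
  simp only [quarticForm, tripleProd, norm_mul, RCLike.norm_conj]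
  rw [mul_comm D]
  have := haA p.1
  have := haA p.2.1
  have := haA p.2.2
  have := hd (outMode p)
  have := hA0 p.1
  have := hA0 p.2.1
  have := hA0 p.2.2
  gcongr

lemma summable_quarticForm {a d : Z2 → ℂ} {A : Z2 → ℝ} {D : ℝ} (hA : Summable A)
    (haA : ∀ n, ‖a n‖ ≤ A n) (hd : ∀ n, ‖d n‖ ≤ D) :
    Summable fun p => ‖quarticForm a a a d p‖ :=
  ((hasSum_tripleProd hA fun n => (norm_nonneg _).trans (haA n)).summable.mul_left D
    ).of_nonneg_of_le (fun _ => norm_nonneg _) (norm_quarticForm_le haA hd)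

/-- The derivative of the quartic monomial along a curve with velocity `d`. -/
def quarticDeriv (a d : Z2 → ℂ) (p : Triple) : ℂ :=
  quarticForm d a a a p + quarticForm a d a a p + quarticForm a a d a p + quarticForm a a a d p

lemma hasDerivAt_quarticForm {a : ℝ → Z2 → ℂ} {d : Z2 → ℂ} {t : ℝ}
    (h : ∀ n, HasDerivAt (fun τ => a τ n) (d n) t) (p : Triple) :
    HasDerivAt (fun τ => quarticForm (a τ) (a τ) (a τ) (a τ) p) (quarticDeriv (a t) d p) t := by
  have hc : ∀ n, HasDerivAt (fun τ => (starRingEnd ℂ) (a τ n)) ((starRingEnd ℂ) (d n)) t :=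
    fun n => (h n).star
  refine ((((h p.1).mul (hc p.2.1)).mul (h p.2.2)).mul (hc (outMode p))).congr_deriv ?_
  simp only [quarticDeriv, quarticForm, Pi.mul_apply]
  ring

lemma quarticDeriv_eq (a d : Z2 → ℂ) (p : Triple) :
    quarticDeriv a d p =
      (starRingEnd ℂ) (quarticForm a a a d (swapFirstOut p)) +
      quarticForm a a a d (swapSecondOut p) +
      (starRingEnd ℂ) (quarticForm a a a d (swapFirstOut (swapFirstThird p))) +
      quarticForm a a a d p := by
  simp only [quarticDeriv, quarticForm_swapFirstOut, quarticForm_swapSecondOut,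
    quarticForm_swapFirstThird, Complex.conj_conj]

/-- A summable majorant of `quarticDeriv`. -/
def quarticMajorant (A : Z2 → ℝ) (D : ℝ) (p : Triple) : ℝ :=
  D * tripleProd A (swapFirstOut p) + D * tripleProd A (swapSecondOut p) +
    D * tripleProd A (swapFirstOut (swapFirstThird p)) + D * tripleProd A p

lemma summable_quarticMajorant {A : Z2 → ℝ} (hA : Summable A) (hA0 : ∀ n, 0 ≤ A n) (D : ℝ) :
    Summable (quarticMajorant A D) := by
  have h := (hasSum_tripleProd hA hA0).summable.mul_left D
  exact (((swapFirstOut.summable_iff.mpr h).add (swapSecondOut.summable_iff.mpr h)).add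
    ((swapFirstThird.trans swapFirstOut).summable_iff.mpr h)).add h

lemma norm_quarticDeriv_le {a d : Z2 → ℂ} {A : Z2 → ℝ} {D : ℝ}
    (haA : ∀ n, ‖a n‖ ≤ A n) (hd : ∀ n, ‖d n‖ ≤ D) (p : Triple) :
    ‖quarticDeriv a d p‖ ≤ quarticMajorant A D p := by
  rw [quarticDeriv_eq]
  have h := norm_quarticForm_le haA hd
  refine norm_add₄_le.trans (add_le_add (add_le_add (add_le_add ?_ (h _)) ?_) (h _))
  · rw [RCLike.norm_conj]; exact h _
  · rw [RCLike.norm_conj]; exact h _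

lemma hasSum_quarticDeriv {a d : Z2 → ℂ} {S : ℂ} (h : HasSum (quarticForm a a a d) S) :
    HasSum (quarticDeriv a d) ((4 * S.re : ℝ) : ℂ) := by
  have h1 := Complex.hasSum_conj'.mpr h
  have h2 := ((swapFirstOut.hasSum_iff.mpr h1).add (swapSecondOut.hasSum_iff.mpr h)).add
    ((swapFirstThird.trans swapFirstOut).hasSum_iff.mpr h1) |>.add h
  have hS : (starRingEnd ℂ) S + S + (starRingEnd ℂ) S + S = ((4 * S.re : ℝ) : ℂ) := by
    have := Complex.add_conj S
    push_cast at this ⊢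
    linear_combination 2 * this
  rw [hS] at h2
  rwa [show quarticDeriv a d = _ from funext (quarticDeriv_eq a d)]

lemma HasSum.quarticForm_fiberwise {a d : Z2 → ℂ} {S : ℂ}
    (h : HasSum (quarticForm a a a d) S) :
    HasSum (fun n => cubicSum a n * (starRingEnd ℂ) (d n)) S := by
  suffices hfun : ∀ n, cubicSum a n * (starRingEnd ℂ) (d n) =
      ∑' p : outMode ⁻¹' {n}, quarticForm a a a d p by
    simpa only [hfun] using h.tsum_fiberwise outMode
  intro n
  unfold cubicSum
  rw [← tsum_mul_right]
  refine tsum_congr fun p => ?_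
  have hp : outMode p.1 = n := p.2
  simp only [quarticForm, cubicTerm, hp]

lemma re_cubicSum_mul_conj_rhs (v : Z2 → ℝ) (a : Z2 → ℂ) (n : Z2) :
    (cubicSum a n * (starRingEnd ℂ) (Complex.I * rhs v a n)).re =
      -((nsq n + v n) * (inner ℝ (a n) (Complex.I * rhs v a n))) := by
  simp only [rhs, Complex.inner, map_mul, map_add, Complex.conj_I, Complex.conj_ofReal,
    Complex.mul_re, Complex.mul_im, Complex.add_re, Complex.add_im, Complex.neg_re,
    Complex.neg_im, Complex.I_re, Complex.I_im, Complex.conj_re, Complex.conj_im,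
    Complex.ofReal_re, Complex.ofReal_im]
  ring

lemma hasDerivAt_energy {v : Z2 → ℝ} {M : ℝ} (hv : ∀ n, |v n| ≤ M)
    {a : ℝ → Z2 → ℂ} (ha : IsSolutionV v a) (hcurve : WeightedL1Curve a)
    (hquad : ∀ t, Summable fun n => |(nsq n + v n) * ‖a t n‖ ^ 2|) (t₀ : ℝ) :
    HasDerivAt (fun t => energy v (a t)) 0 t₀ := by
  obtain ⟨δ, hδ, C, hC⟩ := hcurve.exists_local_bound t₀
  obtain ⟨A, hA, haA⟩ := ha.exists_dominating hv hcurve hδ hC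
  have hM : 0 ≤ M := (abs_nonneg _).trans (hv 0)
  have ht₀ : t₀ ∈ Set.Ioo (t₀ - δ) (t₀ + δ) := ⟨by linarith, by linarith⟩
  have hmem : ∀ {t}, t ∈ Set.Ioo (t₀ - δ) (t₀ + δ) → t ∈ Set.Icc (t₀ - δ) (t₀ + δ) :=
    fun h => Set.Ioo_subset_Icc_self h
  have hA0 : ∀ n, 0 ≤ A n := fun n => (norm_nonneg _).trans (haA t₀ (hmem ht₀) n)
  set D := (1 + M) * C + C ^ 3
  have hD : ∀ t ∈ Set.Icc (t₀ - δ) (t₀ + δ), ∀ n, ‖Complex.I * rhs v (a t) n‖ ≤ D :=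
    fun t ht n => by simpa using sum_norm_rhs_le hv (hcurve.1 t) (hC t ht) {n}
  have hL : ∀ t ∈ Set.Icc (t₀ - δ) (t₀ + δ), ∀ n,
      |nsq n + v n| * ‖a t n‖ ≤ (1 + M) * C := fun t ht n => by
    have h1 := norm_symbol_mul_le hv (a t) n
    rw [norm_mul, Complex.norm_real, Real.norm_eq_abs] at h1
    have h2 := ((hcurve.1 t).le_tsum n fun m _ => weighted_nonneg (a t) m).trans (hC t ht)
    exact h1.trans (by gcongr)
  have hquadDeriv : HasDerivAt (fun t => ∑' n, (nsq n + v n) * ‖a t n‖ ^ 2)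
      (∑' n, (nsq n + v n) * (2 * inner ℝ (a t₀ n) (Complex.I * rhs v (a t₀) n))) t₀ := by
    refine hasDerivAt_tsum_of_isPreconnected
      (g' := fun n t => (nsq n + v n) * (2 * inner ℝ (a t n) (Complex.I * rhs v (a t) n)))
      (((hasSum_tripleConv hA hA0).summable.mul_left (2 * ((1 + M) * C))))
      isOpen_Ioo isPreconnected_Ioo (fun n t _ => ((ha.hasDerivAt n t).norm_sq.const_mul _))
      (fun n t ht => ?_) ht₀ (hquad t₀).of_abs ht₀
    have hcancel : inner ℝ (a t n) (Complex.I * rhs v (a t) n)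
        = inner ℝ (a t n) (Complex.I * cubicSum (a t) n) := by
      simp only [rhs, Complex.inner, Complex.mul_re, Complex.mul_im, Complex.add_re,
        Complex.add_im, Complex.I_re, Complex.I_im, Complex.conj_re, Complex.conj_im,
        Complex.ofReal_re, Complex.ofReal_im]
      ring
    have h1 : |inner ℝ (a t n) (Complex.I * cubicSum (a t) n)|
        ≤ ‖a t n‖ * ‖cubicSum (a t) n‖ := by
      simpa using abs_real_inner_le_norm (a t n) (Complex.I * cubicSum (a t) n)
    have h2 := norm_cubicSum_le hA (haA t (hmem ht)) n
    rw [hcancel, Real.norm_eq_abs, abs_mul, abs_mul, abs_two]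
    calc |nsq n + v n| * (2 * |inner ℝ (a t n) (Complex.I * cubicSum (a t) n)|)
        ≤ |nsq n + v n| * (2 * (‖a t n‖ * ‖cubicSum (a t) n‖)) := by gcongr
      _ = 2 * (|nsq n + v n| * ‖a t n‖) * ‖cubicSum (a t) n‖ := by ring
      _ ≤ 2 * ((1 + M) * C) * ∑' p : outMode ⁻¹' {n}, tripleProd A p := by
          have h3 := hL t (hmem ht) n
          have h4 : 0 ≤ (1 + M) * C := le_trans (by positivity) h3
          gcongr
  have hS := (summable_quarticForm hA (haA t₀ (hmem ht₀)) (hD t₀ (hmem ht₀))).of_norm.hasSum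
  have hquartDeriv := hasDerivAt_tsum_of_isPreconnected
    (g := fun p t => quarticForm (a t) (a t) (a t) (a t) p)
    (g' := fun p t => quarticDeriv (a t) (fun n => Complex.I * rhs v (a t) n) p)
    (summable_quarticMajorant hA hA0 D) isOpen_Ioo isPreconnected_Ioo
    (fun p t _ => hasDerivAt_quarticForm (fun n => ha.hasDerivAt n t) p)
    (fun p t ht => norm_quarticDeriv_le (haA t (hmem ht)) (hD t (hmem ht)) p) ht₀
    (summable_quarticForm hA (haA t₀ (hmem ht₀))
      fun n => (haA t₀ (hmem ht₀) n).trans (hA.le_tsum n fun m _ => hA0 m)).of_norm ht₀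
  rw [(hasSum_quarticDeriv hS).tsum_eq, ← (Complex.hasSum_re hS.quarticForm_fiberwise).tsum_eq]
    at hquartDeriv
  have henergy : (fun t => energy v (a t)) = fun t =>
      (((1 / 2 : ℝ) * ∑' n : Z2, (nsq n + v n) * ‖a t n‖ ^ 2 : ℝ) : ℂ) +
        (1 / 4 : ℂ) * ∑' p, quarticForm (a t) (a t) (a t) (a t) p := by
    funext t
    rw [energy, ← quadEquiv.tsum_eq]
    simp only [quarticTerm_eq_quarticForm]
  rw [henergy]
  refine ((hquadDeriv.const_mul (1 / 2 : ℝ)).ofReal_comp.add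
    (hquartDeriv.const_mul (1 / 4 : ℂ))).congr_deriv ?_
  simp only [re_cubicSum_mul_conj_rhs, tsum_neg, mul_left_comm _ (2 : ℝ), tsum_mul_left]
  push_cast
  ring

/-- **Conservation of energy.** If `v` is bounded and `a` is a Fourier-side solution of the
cubic defocusing NLS with convolution potential which is a continuous curve in the weighted
`ℓ¹` space, then both sums defining the energy converge absolutely and the energy
`ℋ(a(t))` is independent of `t`. -/
theorem energy_conservation
    (v : Z2 → ℝ) (M : ℝ) (hv : ∀ n : Z2, |v n| ≤ M)
    (a : ℝ → Z2 → ℂ)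
    (ha : IsSolutionV v a) (hcurve : WeightedL1Curve a) :
    (∀ t : ℝ, Summable fun n : Z2 => |(nsq n + v n) * ‖a t n‖ ^ 2|) ∧
    (∀ t : ℝ,
      Summable fun q : {q : Quad4 // q.1 - q.2.1 + q.2.2.1 = q.2.2.2} =>
        ‖quarticTerm (a t) q.1‖) ∧
    ∀ t₁ t₂ : ℝ, energy v (a t₁) = energy v (a t₂) := by
  have hquad : ∀ t : ℝ, Summable fun n : Z2 => |(nsq n + v n) * ‖a t n‖ ^ 2| := fun t => by
    have hw := hcurve.1 t
    refine (hw.mul_left ((1 + M) * ∑' n, (1 + nsq n) * ‖a t n‖)).of_nonneg_of_le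
      (fun _ => abs_nonneg _) fun n => ?_
    have h1 := norm_symbol_mul_le hv (a t) n
    rw [norm_mul, Complex.norm_real, Real.norm_eq_abs] at h1
    have h2 : ‖a t n‖ ≤ ∑' n, (1 + nsq n) * ‖a t n‖ :=
      (norm_le_weighted (a t) n).trans (hw.le_tsum n fun m _ => weighted_nonneg (a t) m)
    rw [abs_mul, abs_of_nonneg (sq_nonneg ‖a t n‖)]
    calc |nsq n + v n| * ‖a t n‖ ^ 2 = (|nsq n + v n| * ‖a t n‖) * ‖a t n‖ := by ring
      _ ≤ ((1 + M) * ((1 + nsq n) * ‖a t n‖)) * ∑' n, (1 + nsq n) * ‖a t n‖ :=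
          mul_le_mul h1 h2 (norm_nonneg _) ((by positivity : (0 : ℝ) ≤ _).trans h1)
      _ = _ := by ring
  refine ⟨hquad, fun t => ?_, fun t₁ t₂ => ?_⟩
  · have hs := summable_norm_of_weighted (hcurve.1 t)
    simp only [quarticTerm_eq_quarticForm]
    exact quadEquiv.summable_iff.mpr (summable_quarticForm hs (fun _ => le_rfl)
      fun n => hs.le_tsum n fun m _ => norm_nonneg (a t m))
  · have hderiv := hasDerivAt_energy hv ha hcurve hquad
    exact is_const_of_deriv_eq_zero (fun t => (hderiv t).differentiableAt)
      (fun t => (hderiv t).deriv) t₁ t₂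
end
end
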